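/- arXiv:math/0601347 — 5 statements merged into one kernel-verified Lean document; each statement's English description precedes it below -/
import Mathlib

section
/- Let d ≥ 1 and let C be as in the context. Suppose there exist μ > 0 and ν ≥ 0 such that h(φ) ≥ μ·l(φ) − ν·‖φ‖₂² for every smooth compactly supported φ : ℝ^d → ℂ (a Gårding inequality). Then for almost every x ∈ ℝ^d one has ⟨ξ, C(x)ξ⟩ ≥ μ|ξ|² for all ξ ∈ ℝ^d, i.e. C ≥ μI almost everywhere. -/
open MeasureTheory Matrix

/-- The quadratic form `h(φ) = ∑ᵢⱼ ∫ conj(∂ᵢφ) cᵢⱼ ∂ⱼφ` (its real value). -/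
noncomputable def formH (d : ℕ) (C : (Fin d → ℝ) → Matrix (Fin d) (Fin d) ℝ)
    (φ : (Fin d → ℝ) → ℂ) : ℝ :=
  ∑ i : Fin d, ∑ j : Fin d, ∫ x : Fin d → ℝ,
    ((starRingEnd ℂ) (fderiv ℝ φ x (Pi.single i 1)) * (C x i j : ℂ) *
      fderiv ℝ φ x (Pi.single j 1)).re

/-- The form `l(φ) = ∫ |∇φ|²` of the Laplacian. -/
noncomputable def formL (d : ℕ) (φ : (Fin d → ℝ) → ℂ) : ℝ :=
  ∫ x : Fin d → ℝ, ∑ i : Fin d, ‖fderiv ℝ φ x (Pi.single i 1)‖ ^ 2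

/-- The plane wave with phase `L`, modulated by the real amplitude `χ`. -/
noncomputable def modulatedWave {E : Type*} (χ L : E → ℝ) (x : E) : ℂ :=
  (χ x : ℂ) * Complex.exp ((L x : ℂ) * Complex.I)

lemma norm_modulatedWave {E : Type*} (χ L : E → ℝ) (x : E) : ‖modulatedWave χ L x‖ = |χ x| := by
  simp [modulatedWave, Complex.norm_exp_ofReal_mul_I]

lemma hasCompactSupport_modulatedWave {E : Type*} [TopologicalSpace E] {χ : E → ℝ}
    (hχ : HasCompactSupport χ) (L : E → ℝ) :
    HasCompactSupport (modulatedWave χ L) :=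
  hχ.mono fun x hx h => hx (by simp [modulatedWave, h])

section ModulatedWave

variable {E : Type*} [NormedAddCommGroup E] [NormedSpace ℝ E]

lemma contDiff_modulatedWave {n : WithTop ℕ∞} {χ : E → ℝ} (hχ : ContDiff ℝ n χ) (L : E →L[ℝ] ℝ) :
    ContDiff ℝ n (modulatedWave χ L) :=
  (Complex.ofRealCLM.contDiff.comp hχ).mul
    (((Complex.ofRealCLM.contDiff.comp L.contDiff).mul contDiff_const).cexp)

lemma fderiv_modulatedWave {χ : E → ℝ} {x : E} (hχ : DifferentiableAt ℝ χ x) (L : E →L[ℝ] ℝ)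
    (v : E) :
    fderiv ℝ (modulatedWave χ L) x v =
      Complex.exp ((L x : ℂ) * Complex.I) *
        ((fderiv ℝ χ x v : ℂ) + ((χ x * L v : ℝ) : ℂ) * Complex.I) := by
  have h1 : HasFDerivAt (fun y => (χ y : ℂ)) (Complex.ofRealCLM.comp (fderiv ℝ χ x)) x :=
    Complex.ofRealCLM.hasFDerivAt.comp x hχ.hasFDerivAt
  have h2 : HasFDerivAt (fun y => (L y : ℂ)) (Complex.ofRealCLM.comp L) x :=
    Complex.ofRealCLM.hasFDerivAt.comp x L.hasFDerivAt
  have h3 := h1.mul (h2.mul_const Complex.I).cexp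
  have h4 : HasFDerivAt (modulatedWave χ L) _ x := h3
  rw [h4.fderiv]
  simp
  ring

lemma re_conj_fderiv_modulatedWave_mul {χ : E → ℝ} {x : E} (hχ : DifferentiableAt ℝ χ x)
    (L : E →L[ℝ] ℝ) (v w : E) (c : ℝ) :
    ((starRingEnd ℂ) (fderiv ℝ (modulatedWave χ L) x v) * (c : ℂ) *
      fderiv ℝ (modulatedWave χ L) x w).re =
      c * (fderiv ℝ χ x v * fderiv ℝ χ x w) + L v * L w * (c * χ x ^ 2) := by
  rw [fderiv_modulatedWave hχ, fderiv_modulatedWave hχ, map_mul]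
  have h : (starRingEnd ℂ) (Complex.exp ((L x : ℂ) * Complex.I)) *
      Complex.exp ((L x : ℂ) * Complex.I) = 1 := by
    rw [← Complex.normSq_eq_conj_mul_self, Complex.normSq_eq_norm_sq,
      Complex.norm_exp_ofReal_mul_I]
    simp
  have key : ∀ e e' a b k : ℂ, e' * e = 1 → e' * a * k * (e * b) = a * k * b := by
    intro e e' a b k he
    linear_combination a * k * b * he
  rw [key _ _ _ _ _ h]
  simp
  ring

lemma norm_sq_fderiv_modulatedWave {χ : E → ℝ} {x : E} (hχ : DifferentiableAt ℝ χ x)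
    (L : E →L[ℝ] ℝ) (v : E) :
    ‖fderiv ℝ (modulatedWave χ L) x v‖ ^ 2 = fderiv ℝ χ x v ^ 2 + L v ^ 2 * χ x ^ 2 := by
  rw [fderiv_modulatedWave hχ, norm_mul, Complex.norm_exp_ofReal_mul_I, one_mul,
    ← Complex.normSq_eq_norm_sq, Complex.normSq_add_mul_I]
  ring

end ModulatedWave

lemma integrable_mul_of_ae_bounded {α : Type*} [MeasurableSpace α] {m : Measure α} {c g : α → ℝ}
    (hc : Measurable c) (hb : ∃ M : ℝ, ∀ᵐ x ∂m, |c x| ≤ M) (hg : Integrable g m) :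
    Integrable (fun x => c x * g x) m := by
  obtain ⟨M, hM⟩ := hb
  exact hg.bdd_mul hc.aestronglyMeasurable hM

section Forms

variable {d : ℕ} {χ : (Fin d → ℝ) → ℝ}

lemma integrable_partial_mul_partial (hχ : ContDiff ℝ (⊤ : ℕ∞) χ) (hs : HasCompactSupport χ)
    (v w : Fin d → ℝ) : Integrable fun x => fderiv ℝ χ x v * fderiv ℝ χ x w := by
  have hc (u : Fin d → ℝ) : Continuous fun x => fderiv ℝ χ x u :=
    (hχ.continuous_fderiv (by simp)).clm_apply continuous_const
  exact ((hc v).mul (hc w)).integrable_of_hasCompactSupport (hs.fderiv_apply (𝕜 := ℝ) v).mul_right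

lemma integrable_sq (hχ : ContDiff ℝ (⊤ : ℕ∞) χ) (hs : HasCompactSupport χ) :
    Integrable fun x => χ x ^ 2 := by
  simp only [sq]
  exact (hχ.continuous.mul hχ.continuous).integrable_of_hasCompactSupport hs.mul_right

lemma formH_modulatedWave {C : (Fin d → ℝ) → Matrix (Fin d) (Fin d) ℝ}
    (hCmeas : ∀ i j, Measurable fun x => C x i j)
    (hCbdd : ∀ i j, ∃ M : ℝ, ∀ᵐ x : Fin d → ℝ, |C x i j| ≤ M)
    (hχ : ContDiff ℝ (⊤ : ℕ∞) χ) (hs : HasCompactSupport χ) (L : (Fin d → ℝ) →L[ℝ] ℝ) :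
    formH d C (modulatedWave χ L) =
      (∑ i, ∑ j, ∫ x, C x i j *
        (fderiv ℝ χ x (Pi.single i 1) * fderiv ℝ χ x (Pi.single j 1))) +
      ∑ i, ∑ j, L (Pi.single i 1) * L (Pi.single j 1) * ∫ x, C x i j * χ x ^ 2 := by
  simp only [formH, ← Finset.sum_add_distrib]
  refine Finset.sum_congr rfl fun i _ => Finset.sum_congr rfl fun j _ => ?_
  simp only [fun x => re_conj_fderiv_modulatedWave_mul (hχ.differentiable (by simp) x)]
  rw [integral_add, integral_const_mul]
  · exact integrable_mul_of_ae_bounded (hCmeas i j) (hCbdd i j)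
      (integrable_partial_mul_partial hχ hs _ _)
  · exact (integrable_mul_of_ae_bounded (hCmeas i j) (hCbdd i j) (integrable_sq hχ hs)).const_mul _

lemma formL_modulatedWave (hχ : ContDiff ℝ (⊤ : ℕ∞) χ) (hs : HasCompactSupport χ)
    (L : (Fin d → ℝ) →L[ℝ] ℝ) :
    formL d (modulatedWave χ L) =
      (∑ i, ∫ x, fderiv ℝ χ x (Pi.single i 1) ^ 2) +
      (∑ i, L (Pi.single i 1) ^ 2) * ∫ x, χ x ^ 2 := by
  have h1 (i : Fin d) : Integrable fun x => fderiv ℝ χ x (Pi.single i 1) ^ 2 := by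
    simpa only [sq] using integrable_partial_mul_partial hχ hs (Pi.single i 1) (Pi.single i 1)
  have h2 (i : Fin d) : Integrable fun x => L (Pi.single i 1) ^ 2 * χ x ^ 2 :=
    (integrable_sq hχ hs).const_mul _
  simp only [formL, fun x => norm_sq_fderiv_modulatedWave (hχ.differentiable (by simp) x)]
  rw [integral_finsetSum Finset.univ (f := fun i x => fderiv ℝ χ x (Pi.single i 1) ^ 2 +
    L (Pi.single i 1) ^ 2 * χ x ^ 2) fun i _ => (h1 i).add (h2 i), Finset.sum_mul, ← Finset.sum_add_distrib]
  refine Finset.sum_congr rfl fun i _ => ?_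
  rw [integral_add (h1 i) (h2 i), integral_const_mul]

end Forms

lemma nonneg_of_forall_add_sq_mul_nonneg {a b : ℝ} (h : ∀ t : ℝ, 0 ≤ a + t ^ 2 * b) : 0 ≤ b := by
  by_contra! hb
  have h1 := h (√((|a| + 1) / -b))
  rw [Real.sq_sqrt (div_nonneg (by positivity) (by linarith))] at h1
  have h2 : (|a| + 1) / -b * b = -(|a| + 1) := by
    rw [div_neg, neg_mul, div_mul_cancel₀ _ hb.ne]
  linarith [le_abs_self a]

/-- A locally integrable function whose integral against the square of every test function is
nonnegative is nonnegative almost everywhere. -/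
lemma ae_nonneg_of_forall_integral_mul_sq_nonneg {E : Type*} [NormedAddCommGroup E]
    [NormedSpace ℝ E] [FiniteDimensional ℝ E] [MeasurableSpace E] [BorelSpace E]
    {m : Measure E} [m.IsAddHaarMeasure] {f : E → ℝ} (hf : LocallyIntegrable f m)
    (h : ∀ χ : E → ℝ, ContDiff ℝ (⊤ : ℕ∞) χ → HasCompactSupport χ → 0 ≤ ∫ x, f x * χ x ^ 2 ∂m) :
    ∀ᵐ x ∂m, 0 ≤ f x := by
  have hball (a : E) {r : ℝ} (hr : 0 < r) : 0 ≤ ∫ x in Metric.closedBall a r, f x ∂m := by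
    let χ (n : ℕ) : ContDiffBump a := ⟨r, r + 1 / ((n : ℝ) + 1), hr, by
      have : 0 < 1 / ((n : ℝ) + 1) := by positivity
      linarith⟩
    have hlim : Filter.Tendsto (fun n => ∫ x, f x * χ n x ^ 2 ∂m) Filter.atTop
        (nhds (∫ x, (Metric.closedBall a r).indicator f x ∂m)) := by
      refine tendsto_integral_of_dominated_convergence
        ((Metric.closedBall a (r + 1)).indicator fun x => ‖f x‖) ?_ ?_ ?_ ?_
      · exact fun n => hf.aestronglyMeasurable.mul
          ((χ n).continuous.pow 2).aestronglyMeasurable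
      · exact (integrable_indicator_iff Metric.isClosed_closedBall.measurableSet).2
          (hf.integrableOn_isCompact (isCompact_closedBall a (r + 1))).norm
      · refine fun n => Filter.Eventually.of_forall fun x => ?_
        by_cases hx : x ∈ Metric.closedBall a (r + 1)
        · rw [Set.indicator_of_mem hx, norm_mul, Real.norm_of_nonneg (sq_nonneg _)]
          exact mul_le_of_le_one_right (norm_nonneg _)
            (pow_le_one₀ (χ n).nonneg (χ n).le_one)
        · rw [Set.indicator_of_notMem hx, (χ n).zero_of_le_dist]
          · simp
          · have h1 : 1 / ((n : ℝ) + 1) ≤ 1 := by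
              rw [div_le_one (by positivity)]
              linarith [Nat.cast_nonneg (α := ℝ) n]
            simp only [Metric.mem_closedBall, not_le] at hx
            change r + 1 / ((n : ℝ) + 1) ≤ _
            linarith
      · refine Filter.Eventually.of_forall fun x => ?_
        by_cases hx : x ∈ Metric.closedBall a r
        · rw [Set.indicator_of_mem hx]
          have (n : ℕ) : χ n x = 1 := (χ n).one_of_mem_closedBall hx
          simp [this]
        · rw [Set.indicator_of_notMem hx]
          refine tendsto_const_nhds.congr' ?_
          simp only [Metric.mem_closedBall, not_le] at hx
          filter_upwards [tendsto_one_div_add_atTop_nhds_zero_nat.eventually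
            (gt_mem_nhds (sub_pos.2 hx))] with n hn
          rw [(χ n).zero_of_le_dist]
          · simp
          · change r + 1 / ((n : ℝ) + 1) ≤ _
            linarith
    rw [integral_indicator Metric.isClosed_closedBall.measurableSet] at hlim
    exact ge_of_tendsto' hlim fun n => h _ (χ n).contDiff (χ n).hasCompactSupport
  filter_upwards [IsUnifLocDoublingMeasure.ae_tendsto_average m hf 1] with x hx
  have := hx (fun _ : ℕ => x) (fun n : ℕ => 1 / ((n : ℝ) + 1)) (l := Filter.atTop)
    (tendsto_nhdsWithin_iff.2 ⟨tendsto_one_div_add_atTop_nhds_zero_nat,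
      Filter.Eventually.of_forall fun n => by
        simp only [Set.mem_Ioi]
        positivity⟩)
    (Filter.Eventually.of_forall fun n => Metric.mem_closedBall_self (by positivity))
  refine ge_of_tendsto' this fun n => ?_
  rw [setAverage_eq]
  exact smul_nonneg (by positivity) (hball x (by positivity))

/-- A Gårding inequality `h ≥ μ l - ν ‖·‖₂²` implies strong ellipticity `C ≥ μ I` a.e. -/
theorem garding_implies_strong_ellipticity
    (d : ℕ) (hd : 1 ≤ d)
    (C : (Fin d → ℝ) → Matrix (Fin d) (Fin d) ℝ)
    (hCmeas : ∀ i j, Measurable fun x => C x i j)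
    (hCsymm : ∀ᵐ x : Fin d → ℝ, (C x).IsSymm)
    (hCpos : ∀ᵐ x : Fin d → ℝ, ∀ ξ : Fin d → ℝ, 0 ≤ ξ ⬝ᵥ (C x).mulVec ξ)
    (hCbdd : ∀ i j, ∃ M : ℝ, ∀ᵐ x : Fin d → ℝ, |C x i j| ≤ M)
    (μ ν : ℝ) (hμ : 0 < μ) (hν : 0 ≤ ν)
    (hGarding : ∀ φ : (Fin d → ℝ) → ℂ, ContDiff ℝ (⊤ : ℕ∞) φ → HasCompactSupport φ →
      formH d C φ ≥ μ * formL d φ - ν * ∫ x : Fin d → ℝ, ‖φ x‖ ^ 2) :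
    ∀ᵐ x : Fin d → ℝ, ∀ ξ : Fin d → ℝ,
      μ * ∑ i : Fin d, ξ i ^ 2 ≤ ξ ⬝ᵥ (C x).mulVec ξ := by
  have hdir (k : Fin d → ℝ) : ∀ᵐ x : Fin d → ℝ,
      0 ≤ (∑ i, ∑ j, k i * k j * C x i j) - μ * ∑ i, k i ^ 2 := by
    have hloc (i j : Fin d) : LocallyIntegrable fun x => C x i j := by
      obtain ⟨M, hM⟩ := hCbdd i j
      exact (memLp_top_of_bound (hCmeas i j).aestronglyMeasurable M hM).locallyIntegrable le_top
    refine ae_nonneg_of_forall_integral_mul_sq_nonneg (m := volume) ?_ fun χ hχ hs => ?_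
    · refine LocallyIntegrable.sub ?_ (locallyIntegrable_const _)
      exact locallyIntegrable_finsetSum _ fun i _ => locallyIntegrable_finsetSum _ fun j _ =>
        (hloc i j).smul (k i * k j)
    · have hint (i j : Fin d) : Integrable fun x => k i * k j * (C x i j * χ x ^ 2) :=
        (integrable_mul_of_ae_bounded (hCmeas i j) (hCbdd i j) (integrable_sq hχ hs)).const_mul _
      have hsplit : ∫ x, ((∑ i, ∑ j, k i * k j * C x i j) - μ * ∑ i, k i ^ 2) * χ x ^ 2 =
          (∑ i, ∑ j, k i * k j * ∫ x, C x i j * χ x ^ 2) -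
            μ * (∑ i, k i ^ 2) * ∫ x, χ x ^ 2 := by
        simp only [sub_mul, Finset.sum_mul, mul_assoc (_ * _) (C _ _ _)]
        rw [integral_sub (integrable_finsetSum _ fun i _ => integrable_finsetSum _ fun j _ =>
            hint i j) ((integrable_sq hχ hs).const_mul _), integral_const_mul,
          integral_finsetSum _ fun i _ => integrable_finsetSum _ fun j _ => hint i j]
        simp only [fun i => integral_finsetSum _ fun j (_ : j ∈ Finset.univ) => hint i j,
          integral_const_mul]
      rw [hsplit]
      refine nonneg_of_forall_add_sq_mul_nonneg
        (a := (∑ i, ∑ j, ∫ x, C x i j *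
          (fderiv ℝ χ x (Pi.single i 1) * fderiv ℝ χ x (Pi.single j 1))) -
          μ * (∑ i, ∫ x, fderiv ℝ χ x (Pi.single i 1) ^ 2) + ν * ∫ x, χ x ^ 2) fun t => ?_
      let L : (Fin d → ℝ) →L[ℝ] ℝ := ∑ i, (t * k i) • ContinuousLinearMap.proj i
      have hL (i : Fin d) : L (Pi.single i 1) = t * k i := by
        simp [L, Pi.single_apply]
      have hG := hGarding _ (contDiff_modulatedWave hχ L) (hasCompactSupport_modulatedWave hs L)
      rw [formH_modulatedWave hCmeas hCbdd hχ hs, formL_modulatedWave hχ hs] at hG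
      simp only [norm_modulatedWave, sq_abs, hL, mul_pow, ← Finset.mul_sum] at hG
      have hscale : ∑ i, ∑ j, t * k i * (t * k j) * ∫ x, C x i j * χ x ^ 2 =
          t ^ 2 * ∑ i, ∑ j, k i * k j * ∫ x, C x i j * χ x ^ 2 := by
        simp only [Finset.mul_sum]
        exact Finset.sum_congr rfl fun i _ => Finset.sum_congr rfl fun j _ => by ring
      rw [hscale] at hG
      linarith
  have hseq := ae_all_iff.2 fun n => hdir (TopologicalSpace.denseSeq (Fin d → ℝ) n)
  filter_upwards [hseq] with x hx
  have hclosed : IsClosed {ξ : Fin d → ℝ |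
      0 ≤ (∑ i, ∑ j, ξ i * ξ j * C x i j) - μ * ∑ i, ξ i ^ 2} :=
    isClosed_le continuous_const (by fun_prop)
  intro ξ
  have hξ : 0 ≤ (∑ i, ∑ j, ξ i * ξ j * C x i j) - μ * ∑ i, ξ i ^ 2 :=
    (TopologicalSpace.denseRange_denseSeq (Fin d → ℝ)).induction_on ξ hclosed hx
  have hquad : ξ ⬝ᵥ (C x).mulVec ξ = ∑ i, ∑ j, ξ i * ξ j * C x i j := by
    simp only [dotProduct, mulVec, Finset.mul_sum]
    exact Finset.sum_congr rfl fun i _ => Finset.sum_congr rfl fun j _ => by ring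
  rw [hquad]
  linarith
end

section
/- Let d ≥ 1 and let C be as in the context. Fix a smooth compactly supported φ : ℝ^d → ℂ and ξ ∈ ℝ^d, and for k ∈ ℝ define φ_k : ℝ^d → ℂ by φ_k(x) = e^{ik⟨x,ξ⟩} φ(x). Then lim_{k→∞} k^{−2} h(φ_k) = ∫_{ℝ^d} |φ(x)|² ⟨ξ, C(x)ξ⟩ dx. -/
open MeasureTheory Matrix Filter

lemma fderiv_modulated_apply {d : ℕ} {φ : (Fin d → ℝ) → ℂ} (hφ : Differentiable ℝ φ)
    (ξ : Fin d → ℝ) (k : ℝ) (x : Fin d → ℝ) (i : Fin d) :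
    fderiv ℝ (fun x => Complex.exp (Complex.I * (k : ℂ) * ((∑ i : Fin d, x i * ξ i : ℝ) : ℂ)) * φ x)
      x (Pi.single i 1) =
    Complex.exp (Complex.I * (k : ℂ) * ((∑ i : Fin d, x i * ξ i : ℝ) : ℂ)) *
      (fderiv ℝ φ x (Pi.single i 1) + Complex.I * k * ξ i * φ x) := by
  have hphase : HasFDerivAt (fun x : Fin d → ℝ => ∑ i : Fin d, x i * ξ i)
      (∑ i : Fin d, ξ i • ContinuousLinearMap.proj (R := ℝ) (φ := fun _ : Fin d => ℝ) i) x :=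
    HasFDerivAt.fun_sum fun j _ => (hasFDerivAt_apply j x).mul_const (ξ j)
  have hprod := ((((Complex.ofRealCLM.hasFDerivAt (x := ∑ i, x i * ξ i)).comp x hphase).const_mul
    (Complex.I * (k : ℂ))).cexp).mul (hφ x).hasFDerivAt
  have heq := congrArg (fun L => L (Pi.single i 1)) hprod.fderiv
  refine heq.trans ?_
  simp [Pi.single_apply]
  ring

lemma modulated_term_re (E a b w : ℂ) (hE : ‖E‖ = 1) (c k s t : ℝ) :
    ((starRingEnd ℂ) (E * (a + Complex.I * k * s * w)) * (c : ℂ) *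
      (E * (b + Complex.I * k * t * w))).re =
    c * ((starRingEnd ℂ) a * b).re +
      k * (c * (Complex.I * ((t : ℂ) * (starRingEnd ℂ) a * w - s * (starRingEnd ℂ) w * b)).re) +
      k ^ 2 * (c * (‖w‖ ^ 2 * (s * t))) := by
  have h1 : E.re * E.re + E.im * E.im = 1 := by
    rw [← Complex.normSq_apply, Complex.normSq_eq_norm_sq, hE, one_pow]
  rw [← Complex.normSq_eq_norm_sq, Complex.normSq_apply]
  have h2 : (starRingEnd ℂ) E * E = 1 := by
    rw [mul_comm, Complex.mul_conj, Complex.normSq_apply, h1, Complex.ofReal_one]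
  have h3 : (starRingEnd ℂ) (E * (a + Complex.I * k * s * w)) * (c : ℂ) *
      (E * (b + Complex.I * k * t * w)) = (starRingEnd ℂ) (a + Complex.I * k * s * w) * (c : ℂ) *
      (b + Complex.I * k * t * w) := by
    rw [map_mul]
    linear_combination ((starRingEnd ℂ) (a + Complex.I * k * s * w) * (c : ℂ) *
      (b + Complex.I * k * t * w)) * h2
  rw [h3]
  simp
  ring

lemma integrable_bdd_mul_compactSupport {d : ℕ} {c g : (Fin d → ℝ) → ℝ} (hc : Measurable c)
    (hb : ∃ M : ℝ, ∀ᵐ x, |c x| ≤ M) (hg : Continuous g) (hgc : HasCompactSupport g) :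
    Integrable fun x => c x * g x := by
  obtain ⟨M, hM⟩ := hb
  exact (hg.integrable_of_hasCompactSupport hgc).bdd_mul hc.aestronglyMeasurable hM

lemma tendsto_inv_sq_mul_quadratic (A B D : ℝ) :
    Tendsto (fun k : ℝ => (k ^ 2)⁻¹ * (A + k * B + k ^ 2 * D)) atTop (nhds D) := by
  have h : Tendsto (fun k : ℝ => (k⁻¹) ^ 2 * A + k⁻¹ * B + D) atTop (nhds (0 ^ 2 * A + 0 * B + D)) :=
    (((tendsto_inv_atTop_zero.pow 2).mul_const A).add
      (tendsto_inv_atTop_zero.mul_const B)).add_const D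
  have h0 : (0 : ℝ) ^ 2 * A + 0 * B + D = D := by ring
  rw [h0] at h
  refine h.congr' ?_
  filter_upwards [eventually_gt_atTop 0] with k hk
  field_simp

lemma tendsto_inv_sq_mul_integral_quadratic {α : Type*} [MeasurableSpace α] {μ : Measure α}
    {a b c : α → ℝ} {F : ℝ → α → ℝ} (ha : Integrable a μ) (hb : Integrable b μ)
    (hc : Integrable c μ) (hF : ∀ k x, F k x = a x + k * b x + k ^ 2 * c x) :
    Tendsto (fun k : ℝ => (k ^ 2)⁻¹ * ∫ x, F k x ∂μ) atTop (nhds (∫ x, c x ∂μ)) := by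
  refine (tendsto_inv_sq_mul_quadratic (∫ x, a x ∂μ) (∫ x, b x ∂μ) _).congr fun k => ?_
  simp_rw [hF]
  have hab : Integrable (fun x => a x + k * b x) μ := ha.add (hb.const_mul k)
  rw [integral_add hab (hc.const_mul (k ^ 2)),
    integral_add ha (hb.const_mul k), integral_const_mul, integral_const_mul]

/-- For `φ_k(x) = e^{ik⟨x,ξ⟩} φ(x)` one has `k⁻² h(φ_k) → ∫ |φ(x)|² ⟨ξ, C(x)ξ⟩ dx`
as `k → ∞`. -/
theorem tendsto_formH_modulated
    (d : ℕ) (hd : 1 ≤ d)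
    (C : (Fin d → ℝ) → Matrix (Fin d) (Fin d) ℝ)
    (hCmeas : ∀ i j, Measurable fun x => C x i j)
    (hCsymm : ∀ᵐ x : Fin d → ℝ, (C x).IsSymm)
    (hCpos : ∀ᵐ x : Fin d → ℝ, ∀ ξ : Fin d → ℝ, 0 ≤ ξ ⬝ᵥ (C x).mulVec ξ)
    (hCbdd : ∀ i j, ∃ M : ℝ, ∀ᵐ x : Fin d → ℝ, |C x i j| ≤ M)
    (φ : (Fin d → ℝ) → ℂ) (hφ : ContDiff ℝ (⊤ : ℕ∞) φ) (hφc : HasCompactSupport φ)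
    (ξ : Fin d → ℝ) :
    Tendsto
      (fun k : ℝ => (k ^ 2)⁻¹ *
        formH d C (fun x => Complex.exp (Complex.I * (k : ℂ) * ((∑ i : Fin d, x i * ξ i : ℝ) : ℂ)) * φ x))
      atTop
      (nhds (∫ x : Fin d → ℝ, ‖φ x‖ ^ 2 * (ξ ⬝ᵥ (C x).mulVec ξ))) := by
  have hdiff : Differentiable ℝ φ := hφ.differentiable (by simp)
  have hcont : Continuous φ := hφ.continuous
  have hdcont (i : Fin d) : Continuous fun x => fderiv ℝ φ x (Pi.single i 1) :=
    (hφ.continuous_fderiv (by simp)).clm_apply continuous_const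
  have hsupp (g : (Fin d → ℝ) → ℝ) (hg : ∀ x, φ x = 0 → fderiv ℝ φ x = 0 → g x = 0) :
      HasCompactSupport g := by
    refine HasCompactSupport.intro hφc fun x hx => hg x (image_eq_zero_of_notMem_tsupport hx) ?_
    exact image_eq_zero_of_notMem_tsupport fun h => hx (tsupport_fderiv_subset ℝ h)
  have hintA (i j : Fin d) : Integrable fun x => C x i j *
      ((starRingEnd ℂ) (fderiv ℝ φ x (Pi.single i 1)) * fderiv ℝ φ x (Pi.single j 1)).re :=
    integrable_bdd_mul_compactSupport (hCmeas i j) (hCbdd i j)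
      (Complex.continuous_re.comp ((Complex.continuous_conj.comp (hdcont i)).mul (hdcont j)))
      (hsupp _ fun x _ h => by simp [h])
  have hintB (i j : Fin d) : Integrable fun x => C x i j *
      (Complex.I * ((ξ j : ℂ) * (starRingEnd ℂ) (fderiv ℝ φ x (Pi.single i 1)) * φ x -
        ξ i * (starRingEnd ℂ) (φ x) * fderiv ℝ φ x (Pi.single j 1))).re :=
    integrable_bdd_mul_compactSupport (hCmeas i j) (hCbdd i j)
      (Complex.continuous_re.comp (continuous_const.mul
        (((continuous_const.mul (Complex.continuous_conj.comp (hdcont i))).mul hcont).sub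
          ((continuous_const.mul (Complex.continuous_conj.comp hcont)).mul (hdcont j)))))
      (hsupp _ fun x h _ => by simp [h])
  have hintD (i j : Fin d) : Integrable fun x => C x i j * (‖φ x‖ ^ 2 * (ξ i * ξ j)) :=
    integrable_bdd_mul_compactSupport (hCmeas i j) (hCbdd i j)
      ((hcont.norm.pow 2).mul continuous_const) (hsupp _ fun x h _ => by simp [h])
  have hlimit : ∫ x : Fin d → ℝ, ‖φ x‖ ^ 2 * (ξ ⬝ᵥ (C x).mulVec ξ) =
      ∑ i, ∑ j, ∫ x, C x i j * (‖φ x‖ ^ 2 * (ξ i * ξ j)) := by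
    simp_rw [← integral_finsetSum _ fun j _ => hintD _ j]
    rw [← integral_finsetSum _ fun i _ => integrable_finsetSum _ fun j _ => hintD i j]
    congr 1 with x
    simp only [dotProduct, mulVec, Finset.mul_sum]
    exact Finset.sum_congr rfl fun i _ => Finset.sum_congr rfl fun j _ => by ring
  rw [hlimit]
  simp only [formH, Finset.mul_sum]
  refine tendsto_finsetSum _ fun i _ => tendsto_finsetSum _ fun j _ => ?_
  refine tendsto_inv_sq_mul_integral_quadratic (hintA i j) (hintB i j) (hintD i j) fun k x => ?_
  rw [fderiv_modulated_apply hdiff, fderiv_modulated_apply hdiff, modulated_term_re]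
  rw [mul_assoc, mul_comm, mul_comm (k : ℂ), ← Complex.ofReal_mul, Complex.norm_exp_ofReal_mul_I]
end

section
/- Let d ≥ 1, let ρ : ℝ → [0,∞) be continuous with compact support, let φ : ℝ^d → ℂ be a Schwartz function and let t > 0. Then (2t)^{−1} ∫_{ℝ^d × ℝ^d} t^{−d/2} ρ(|x − y|² t^{−1}) |φ(x) − φ(y)|² d(x,y) = 2 ∫_{ℝ^d} |φ̂(ξ)|² ( ∫_{ℝ^d} ρ(|x|²) t^{−1} sin²(π t^{1/2} ⟨ξ, x⟩) dx ) dξ. -/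
open MeasureTheory FourierTransform RealInnerProductSpace Real

section

variable {V : Type*} [NormedAddCommGroup V] [InnerProductSpace ℝ V] [FiniteDimensional ℝ V]
  [MeasurableSpace V] [BorelSpace V]

theorem fourier_comp_add_right (f : V → ℂ) (z ξ : V) :
    𝓕 (fun y ↦ f (y + z)) ξ = 𝐞 ⟪z, ξ⟫ • 𝓕 f ξ :=
  congrFun (VectorFourier.fourierIntegral_comp_add_right 𝐞 volume (innerₗ V) f z) ξ

theorem norm_sub_fourierChar_smul_sq (w : ℂ) (a : ℝ) :
    ‖w - 𝐞 a • w‖ ^ 2 = 4 * Real.sin (π * a) ^ 2 * ‖w‖ ^ 2 := by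
  have h : w - 𝐞 a • w = -((Complex.exp (Complex.I * (2 * π * a : ℝ)) - 1) * w) := by
    rw [Circle.smul_def, Real.fourierChar_apply, smul_eq_mul, mul_comm Complex.I]
    ring
  rw [h, norm_neg, norm_mul, Complex.norm_exp_I_mul_ofReal_sub_one, mul_pow, Real.norm_eq_abs,
    sq_abs, show 2 * π * a / 2 = π * a by ring]
  ring

theorem SchwartzMap.integrable_norm_sq (f : SchwartzMap V ℂ) : Integrable fun x ↦ ‖f x‖ ^ 2 :=
  (f.memLp 2).integrable_norm_pow (by norm_num)

theorem SchwartzMap.integral_norm_sub_comp_add_right_sq (φ : SchwartzMap V ℂ) (z : V) :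
    ∫ y, ‖φ y - φ (y + z)‖ ^ 2 =
      ∫ ξ, 4 * Real.sin (π * ⟪ξ, z⟫) ^ 2 * ‖𝓕 (⇑φ) ξ‖ ^ 2 := by
  have h := (φ - φ.compSubConstCLM ℂ (-z)).integral_norm_sq_fourier
  have h_fourier (ξ : V) : 𝓕 (φ.compSubConstCLM ℂ (-z)) ξ = 𝐞 ⟪z, ξ⟫ • 𝓕 (⇑φ) ξ := by
    rw [SchwartzMap.fourier_coe, ← fourier_comp_add_right]
    refine congrArg (fun f : V → ℂ ↦ 𝓕 f ξ) (funext fun y ↦ ?_)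
    simp
  have h_sub : 𝓕 (φ - φ.compSubConstCLM ℂ (-z)) = 𝓕 φ - 𝓕 (φ.compSubConstCLM ℂ (-z)) :=
    map_sub (fourierCLM ℂ (SchwartzMap V ℂ)) _ _
  simp only [h_sub, sub_apply, h_fourier, SchwartzMap.compSubConstCLM_apply,
    sub_neg_eq_add] at h
  rw [← h]
  simp only [SchwartzMap.fourier_coe, norm_sub_fourierChar_smul_sq, real_inner_comm]

/-- The quadratic form of a translation-invariant kernel `k` is the Fourier multiplier with symbol
`ξ ↦ 4 ∫ k(z) sin²(π⟨ξ, z⟩) dz`. -/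
theorem SchwartzMap.integral_kernel_mul_norm_sub_sq (φ : SchwartzMap V ℂ) {k : V → ℝ}
    (hk : Integrable k) :
    ∫ p : V × V, k (p.2 - p.1) * ‖φ p.1 - φ p.2‖ ^ 2 =
      4 * ∫ ξ, ‖𝓕 (⇑φ) ξ‖ ^ 2 * ∫ z, k z * Real.sin (π * ⟪ξ, z⟫) ^ 2 := by
  have hF (k : V → ℝ) (hk : Integrable k) : Integrable (fun p : V × V ↦
      k p.1 * (4 * Real.sin (π * ⟪p.2, p.1⟫) ^ 2 * ‖𝓕 (⇑φ) p.2‖ ^ 2)) := by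
    have hm := hk.mul_prod (ν := volume) (𝓕 φ).integrable_norm_sq
    refine (hm.bdd_mul (c := 4) (f := fun p : V × V ↦ 4 * Real.sin (π * ⟪p.2, p.1⟫) ^ 2)
      (by fun_prop) (.of_forall fun p ↦ ?_)).congr (.of_forall fun p ↦ ?_)
    · rw [Real.norm_of_nonneg (by positivity)]
      linarith [Real.sin_sq_le_one (π * ⟪p.2, p.1⟫)]
    · simp only [SchwartzMap.fourier_coe]
      ring
  have hH : Integrable (fun p : V × V ↦ k p.2 * ‖φ p.1 - φ (p.1 + p.2)‖ ^ 2) := by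
    refine (integrable_prod_iff' ?_).2 ⟨.of_forall fun z ↦ ?_, ?_⟩
    · have h_cont := φ.continuous
      have h_norm : Continuous fun p : V × V ↦ ‖φ p.1 - φ (p.1 + p.2)‖ ^ 2 := by fun_prop
      exact hk.aestronglyMeasurable.comp_snd.mul h_norm.aestronglyMeasurable
    · have h_diff := (φ - φ.compSubConstCLM ℂ (-z)).integrable_norm_sq.const_mul (k z)
      simpa using h_diff
    · refine (hF _ hk.norm).integral_prod_left.congr (.of_forall fun z ↦ ?_)
      simp only [norm_mul, norm_pow, norm_norm, integral_const_mul,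
        φ.integral_norm_sub_comp_add_right_sq]
  calc
    _ = ∫ p : V × V, k p.2 * ‖φ p.1 - φ (p.1 + p.2)‖ ^ 2 := by
      rw [Measure.volume_eq_prod, ← (measurePreserving_prod_add (volume : Measure V) volume).integral_comp
        (MeasurableEquiv.shearAddRight V).measurableEmbedding]
      simp
    _ = ∫ z, ∫ ξ, k z * (4 * Real.sin (π * ⟪ξ, z⟫) ^ 2 * ‖𝓕 (⇑φ) ξ‖ ^ 2) := by
      rw [Measure.volume_eq_prod, integral_prod_symm _ hH]
      simp only [integral_const_mul, φ.integral_norm_sub_comp_add_right_sq]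
    _ = ∫ ξ, ∫ z, k z * (4 * Real.sin (π * ⟪ξ, z⟫) ^ 2 * ‖𝓕 (⇑φ) ξ‖ ^ 2) :=
      integral_integral_swap (hF k hk)
    _ = _ := by
      simp only [← integral_const_mul]
      congr! 4
      ring

end

/-- For a continuous compactly supported `ρ ≥ 0`, a Schwartz function `φ` and `t > 0`,
`(2t)⁻¹ ∬ t^{-d/2} ρ(|x-y|²/t) |φ(x)-φ(y)|² d(x,y)
  = 2 ∫ |φ̂(ξ)|² (∫ ρ(|x|²) t⁻¹ sin²(π √t ⟨ξ,x⟩) dx) dξ`. -/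
theorem double_integral_eq_fourier_sin_sq
    (d : ℕ) (hd : 1 ≤ d)
    (ρ : ℝ → ℝ) (hρcont : Continuous ρ) (hρsupp : HasCompactSupport ρ)
    (hρnonneg : ∀ s, 0 ≤ ρ s)
    (φ : SchwartzMap (EuclideanSpace ℝ (Fin d)) ℂ)
    (t : ℝ) (ht : 0 < t) :
    (2 * t)⁻¹ * ∫ p : EuclideanSpace ℝ (Fin d) × EuclideanSpace ℝ (Fin d),
        t ^ (-(d : ℝ) / 2) * ρ (‖p.1 - p.2‖ ^ 2 / t) * ‖φ p.1 - φ p.2‖ ^ 2 =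
      2 * ∫ ξ : EuclideanSpace ℝ (Fin d), ‖𝓕 (⇑φ) ξ‖ ^ 2 *
        ∫ x : EuclideanSpace ℝ (Fin d),
          ρ (‖x‖ ^ 2) * t⁻¹ * Real.sin (π * Real.sqrt t * ⟪ξ, x⟫) ^ 2 := by
  have h_scale : 0 < √t := Real.sqrt_pos.2 ht
  have h_integrable : Integrable fun z : EuclideanSpace ℝ (Fin d) ↦
      t ^ (-(d : ℝ) / 2) * ρ (‖z‖ ^ 2 / t) := by
    refine Integrable.const_mul (Continuous.integrable_of_hasCompactSupport (by fun_prop) ?_) _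
    obtain ⟨R, hR⟩ := hρsupp.isCompact.isBounded.subset_closedBall 0
    refine HasCompactSupport.of_support_subset_isCompact
      (isCompact_closedBall (0 : EuclideanSpace ℝ (Fin d)) √(R * t)) fun z hz ↦ ?_
    have h_norm := hR (subset_tsupport _ hz)
    rw [mem_closedBall_zero_iff, Real.norm_of_nonneg (by positivity), div_le_iff₀ ht] at h_norm
    exact mem_closedBall_zero_iff.2 (Real.le_sqrt_of_sq_le h_norm)
  have h_inner (ξ : EuclideanSpace ℝ (Fin d)) :
      ∫ z : EuclideanSpace ℝ (Fin d),
          t ^ (-(d : ℝ) / 2) * ρ (‖z‖ ^ 2 / t) * Real.sin (π * ⟪ξ, z⟫) ^ 2 =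
        t * ∫ x : EuclideanSpace ℝ (Fin d),
          ρ (‖x‖ ^ 2) * t⁻¹ * Real.sin (π * √t * ⟪ξ, x⟫) ^ 2 := by
    have h_comp := Measure.integral_comp_smul volume (fun z : EuclideanSpace ℝ (Fin d) ↦
      ρ (‖z‖ ^ 2 / t) * Real.sin (π * ⟪ξ, z⟫) ^ 2) √t
    have h_pow : |(√t ^ d)⁻¹| = t ^ (-(d : ℝ) / 2) := by
      rw [abs_of_pos (by positivity), Real.sqrt_eq_rpow, ← Real.rpow_mul_natCast ht.le,
        ← Real.rpow_neg ht.le]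
      congr 1
      ring
    rw [finrank_euclideanSpace_fin, h_pow, smul_eq_mul, ← integral_const_mul] at h_comp
    simp only [mul_assoc] at h_comp ⊢
    rw [← h_comp, ← integral_const_mul]
    congr! 2 with x
    rw [norm_smul, Real.norm_of_nonneg h_scale.le, mul_pow, Real.sq_sqrt ht.le,
      mul_div_cancel_left₀ _ ht.ne', inner_smul_right]
    field_simp
  have h_kernel := φ.integral_kernel_mul_norm_sub_sq h_integrable
  simp only [norm_sub_rev] at h_kernel ⊢
  rw [h_kernel]
  simp only [h_inner, mul_left_comm _ t, integral_const_mul]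
  field_simp
  norm_num
end

section
/- Let d ≥ 1, let ρ : ℝ → [0,∞) be continuous with compact support, and let φ : ℝ^d → ℂ be smooth with compact support. Then lim_{t→0⁺} (2t)^{−1} ∫_{ℝ^d × ℝ^d} t^{−d/2} ρ(|x − y|² t^{−1}) |φ(x) − φ(y)|² d(x,y) = (2d)^{−1} ( ∫_{ℝ^d} ρ(|x|²) |x|² dx ) ∫_{ℝ^d} |∇φ(x)|² dx. -/
open MeasureTheory Filter
open scoped Topology

section RadialWeight

variable {E : Type*} [NormedAddCommGroup E] {ρ : ℝ → ℝ}

/-- A compactly supported function of `‖z‖ ^ 2` vanishes outside a ball. -/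
lemma HasCompactSupport.exists_comp_norm_sq_eq_zero (hρ : HasCompactSupport ρ) :
    ∃ R : ℝ, 0 ≤ R ∧ ∀ z : E, ρ (‖z‖ ^ 2) ≠ 0 → ‖z‖ ≤ R := by
  obtain ⟨R, hR⟩ := hρ.isCompact.isBounded.exists_norm_le
  refine ⟨max R 1, by positivity, fun z hz => ?_⟩
  have h := hR _ (subset_tsupport ρ hz)
  rw [Real.norm_of_nonneg (by positivity)] at h
  by_contra! hlt
  obtain ⟨h₁, h₂⟩ := max_lt_iff.mp hlt
  nlinarith

lemma HasCompactSupport.comp_norm_sq [ProperSpace E] (hρ : HasCompactSupport ρ) :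
    HasCompactSupport fun z : E => ρ (‖z‖ ^ 2) := by
  obtain ⟨R, -, hR⟩ := hρ.exists_comp_norm_sq_eq_zero (E := E)
  refine .of_support_subset_isCompact (isCompact_closedBall 0 R) fun z hz => ?_
  simpa using hR z hz

variable [InnerProductSpace ℝ E] [FiniteDimensional ℝ E] [MeasurableSpace E] [BorelSpace E]

lemma integrable_comp_norm_sq_mul (hρc : Continuous ρ) (hρ : HasCompactSupport ρ)
    {f : E → ℝ} (hf : Continuous f) : Integrable fun z : E => ρ (‖z‖ ^ 2) * f z :=
  Continuous.integrable_of_hasCompactSupport (by fun_prop) (hρ.comp_norm_sq.mul_right)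

/-- The second moment of a radial weight in the direction `v` depends on `v` only through
its norm. -/
lemma integral_comp_norm_sq_mul_inner_sq_congr (ρ : ℝ → ℝ) {v w : E} (h : ‖v‖ = ‖w‖) :
    ∫ z : E, ρ (‖z‖ ^ 2) * inner ℝ v z ^ 2 = ∫ z : E, ρ (‖z‖ ^ 2) * inner ℝ w z ^ 2 := by
  set T := (ℝ ∙ (v - w))ᗮ.reflection
  have hT : T v = w := Submodule.reflection_sub h
  rw [← T.measurePreserving.integral_comp T.toHomeomorph.measurableEmbedding
    (fun z => ρ (‖z‖ ^ 2) * inner ℝ w z ^ 2)]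
  simp [← hT]

variable {ι : Type*} [Fintype ι]

lemma card_mul_integral_comp_norm_sq_mul_inner_sq (hρc : Continuous ρ)
    (hρ : HasCompactSupport ρ) (b : OrthonormalBasis ι ℝ E) (v : E) :
    Fintype.card ι * ∫ z : E, ρ (‖z‖ ^ 2) * inner ℝ v z ^ 2
      = ‖v‖ ^ 2 * ∫ z : E, ρ (‖z‖ ^ 2) * ‖z‖ ^ 2 := by
  have hb (i : ι) : ∫ z : E, ρ (‖z‖ ^ 2) * inner ℝ v z ^ 2
      = ‖v‖ ^ 2 * ∫ z : E, ρ (‖z‖ ^ 2) * inner ℝ (b i) z ^ 2 := by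
    rw [integral_comp_norm_sq_mul_inner_sq_congr ρ (v := v) (w := ‖v‖ • b i)
      (by simp [norm_smul]), ← integral_const_mul]
    congr with z
    rw [real_inner_smul_left]
    ring
  calc Fintype.card ι * ∫ z : E, ρ (‖z‖ ^ 2) * inner ℝ v z ^ 2
      = ∑ i, ‖v‖ ^ 2 * ∫ z : E, ρ (‖z‖ ^ 2) * inner ℝ (b i) z ^ 2 := by
        simp [← hb]
    _ = ‖v‖ ^ 2 * ∫ z : E, ρ (‖z‖ ^ 2) * ‖z‖ ^ 2 := by
        rw [← Finset.mul_sum, ← integral_finsetSum _ fun i _ =>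
          integrable_comp_norm_sq_mul hρc hρ (by fun_prop)]
        simp_rw [← Finset.mul_sum, b.sum_sq_inner_right]

lemma card_mul_integral_comp_norm_sq_mul_apply_sq (hρc : Continuous ρ)
    (hρ : HasCompactSupport ρ) (b : OrthonormalBasis ι ℝ E) (l : E →L[ℝ] ℝ) :
    Fintype.card ι * ∫ z : E, ρ (‖z‖ ^ 2) * l z ^ 2
      = (∑ i, l (b i) ^ 2) * ∫ z : E, ρ (‖z‖ ^ 2) * ‖z‖ ^ 2 := by
  set v := (InnerProductSpace.toDual ℝ E).symm l with hv
  have hl (z : E) : l z = inner ℝ v z := by simp [hv]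
  simp_rw [hl, b.sum_sq_inner_left]
  exact card_mul_integral_comp_norm_sq_mul_inner_sq hρc hρ b v

/-- A radial weight has isotropic second moments. -/
lemma card_mul_integral_comp_norm_sq_mul_norm_apply_sq (hρc : Continuous ρ)
    (hρ : HasCompactSupport ρ) (b : OrthonormalBasis ι ℝ E) (A : E →L[ℝ] ℂ) :
    Fintype.card ι * ∫ z : E, ρ (‖z‖ ^ 2) * ‖A z‖ ^ 2
      = (∑ i, ‖A (b i)‖ ^ 2) * ∫ z : E, ρ (‖z‖ ^ 2) * ‖z‖ ^ 2 := by
  have hA (z : E) : ‖A z‖ ^ 2 = (Complex.reCLM ∘L A) z ^ 2 + (Complex.imCLM ∘L A) z ^ 2 := by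
    rw [Complex.sq_norm, Complex.normSq_apply]
    simp [sq]
  simp_rw [hA, mul_add, Finset.sum_add_distrib]
  rw [integral_add (integrable_comp_norm_sq_mul hρc hρ (by fun_prop))
    (integrable_comp_norm_sq_mul hρc hρ (by fun_prop)), mul_add,
    card_mul_integral_comp_norm_sq_mul_apply_sq hρc hρ b,
    card_mul_integral_comp_norm_sq_mul_apply_sq hρc hρ b, add_mul]

end RadialWeight

section DifferenceQuotient

variable {E F : Type*} [NormedAddCommGroup E] [InnerProductSpace ℝ E]
  [NormedAddCommGroup F] {ρ : ℝ → ℝ} {φ : E → F}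

/-- The weighted difference is supported where `z` is in the ball of radius `R` and `y` is in
the `R`-thickening of the support of `φ`. -/
lemma mem_closedBall_prod_cthickening_of_weighted_difference_ne_zero {R s : ℝ}
    (hR : ∀ z : E, ρ (‖z‖ ^ 2) ≠ 0 → ‖z‖ ≤ R) (hs₀ : 0 ≤ s) (hs₁ : s ≤ 1) {p : E × E}
    (hp : ρ (‖p.1‖ ^ 2) * ‖φ (p.2 + s • p.1) - φ p.2‖ ^ 2 ≠ 0) :
    p ∈ Metric.closedBall 0 R ×ˢ Metric.cthickening R (tsupport φ) := by
  have hz : ‖p.1‖ ≤ R := hR _ (left_ne_zero_of_mul hp)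
  refine ⟨by simpa using hz, ?_⟩
  by_cases hy : φ p.2 = 0
  · refine Metric.mem_cthickening_of_dist_le _ (p.2 + s • p.1) _ _ (subset_tsupport φ ?_) ?_
    · intro h
      simp [h, hy] at hp
    · rw [dist_self_add_right, norm_smul, Real.norm_of_nonneg hs₀]
      exact (mul_le_of_le_one_left (norm_nonneg _) hs₁).trans hz
  · exact Metric.self_subset_cthickening _ (subset_tsupport φ hy)

variable [FiniteDimensional ℝ E]

lemma hasCompactSupport_weighted_difference (hρ : HasCompactSupport ρ)
    (hφ : HasCompactSupport φ) {s : ℝ} (hs₀ : 0 ≤ s) (hs₁ : s ≤ 1) :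
    HasCompactSupport fun p : E × E => ρ (‖p.1‖ ^ 2) * ‖φ (p.2 + s • p.1) - φ p.2‖ ^ 2 := by
  obtain ⟨R, -, hR⟩ := hρ.exists_comp_norm_sq_eq_zero (E := E)
  exact .of_support_subset_isCompact
    ((isCompact_closedBall 0 R).prod hφ.isCompact.cthickening) fun _ hp =>
    mem_closedBall_prod_cthickening_of_weighted_difference_ne_zero hR hs₀ hs₁ hp

variable [MeasurableSpace E] [BorelSpace E]

lemma integrable_weighted_difference (hρc : Continuous ρ) (hρ : HasCompactSupport ρ)
    (hφc : Continuous φ) (hφ : HasCompactSupport φ) {s : ℝ} (hs₀ : 0 ≤ s) (hs₁ : s ≤ 1) :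
    Integrable fun p : E × E => ρ (‖p.1‖ ^ 2) * ‖φ (p.2 + s • p.1) - φ p.2‖ ^ 2 :=
  Continuous.integrable_of_hasCompactSupport (by fun_prop)
    (hasCompactSupport_weighted_difference hρ hφ hs₀ hs₁)

/-- The substitution `x = y + s z`. -/
lemma integral_weighted_difference_rescale (hρc : Continuous ρ) (hρ : HasCompactSupport ρ)
    (hφc : Continuous φ) (hφ : HasCompactSupport φ) {s : ℝ} (hs₀ : 0 < s) (hs₁ : s ≤ 1) :
    ∫ p : E × E, ρ (‖p.1 - p.2‖ ^ 2 / s ^ 2) * ‖φ p.1 - φ p.2‖ ^ 2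
      = s ^ Module.finrank ℝ E *
        ∫ p : E × E, ρ (‖p.1‖ ^ 2) * ‖φ (p.2 + s • p.1) - φ p.2‖ ^ 2 := by
  set σ : ℝ → ℝ := fun u => ρ (u / s ^ 2)
  have hσc : Continuous σ := by fun_prop
  have hσ : HasCompactSupport σ :=
    hρ.comp_homeomorph (Homeomorph.mulRight₀ (s ^ 2)⁻¹ (by positivity))
  have hshear : ∫ p : E × E, ρ (‖p.1 - p.2‖ ^ 2 / s ^ 2) * ‖φ p.1 - φ p.2‖ ^ 2
      = ∫ p : E × E, σ (‖p.1‖ ^ 2) * ‖φ (p.2 + (1 : ℝ) • p.1) - φ p.2‖ ^ 2 := by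
    have hmp := measurePreserving_sub_prod (volume : Measure E) (volume : Measure E)
    have hint := integrable_weighted_difference hσc hσ hφc hφ zero_le_one le_rfl
    rw [Measure.volume_eq_prod] at hint ⊢
    have := integral_map hmp.aemeasurable (hmp.map_eq.symm ▸ hint.aestronglyMeasurable)
    rw [hmp.map_eq] at this
    rw [this]
    simp [σ]
  rw [hshear, Measure.volume_eq_prod,
    integral_prod _ (integrable_weighted_difference hσc hσ hφc hφ zero_le_one le_rfl),
    integral_prod _ (integrable_weighted_difference hρc hρ hφc hφ hs₀.le hs₁)]
  have hscale := Measure.integral_comp_smul (volume : Measure E)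
    (fun z => ∫ y : E, σ (‖z‖ ^ 2) * ‖φ (y + (1 : ℝ) • z) - φ y‖ ^ 2) s
  have hσρ (z : E) : σ (‖s • z‖ ^ 2) = ρ (‖z‖ ^ 2) := by
    simp only [σ, norm_smul, Real.norm_of_nonneg hs₀.le]
    congr 1
    field_simp
  simp only [hσρ, one_smul, abs_of_pos (inv_pos.mpr (pow_pos hs₀ _)), smul_eq_mul] at hscale ⊢
  rw [hscale, mul_inv_cancel_left₀ (by positivity)]

variable [NormedSpace ℝ F]

/-- Dominated convergence for the weighted difference quotients of `φ`. -/
lemma tendsto_integral_weighted_difference_quotient (hρc : Continuous ρ)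
    (hρ : HasCompactSupport ρ) (hφc : ContDiff ℝ 1 φ) (hφ : HasCompactSupport φ) :
    Tendsto (fun s : ℝ => (s ^ 2)⁻¹ *
        ∫ p : E × E, ρ (‖p.1‖ ^ 2) * ‖φ (p.2 + s • p.1) - φ p.2‖ ^ 2) (𝓝[>] 0)
      (𝓝 (∫ p : E × E, ρ (‖p.1‖ ^ 2) * ‖fderiv ℝ φ p.2 p.1‖ ^ 2)) := by
  obtain ⟨R, hR₀, hR⟩ := hρ.exists_comp_norm_sq_eq_zero (E := E)
  obtain ⟨C, hC⟩ := hρ.exists_bound_of_continuous hρc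
  obtain ⟨L, hL⟩ := hφc.lipschitzWith_of_hasCompactSupport hφ one_ne_zero
  have hcont := hφc.continuous
  set K : Set (E × E) := Metric.closedBall 0 R ×ˢ Metric.cthickening R (tsupport φ)
  have hK : IsCompact K := (isCompact_closedBall 0 R).prod hφ.isCompact.cthickening
  simp_rw [← integral_const_mul]
  refine tendsto_integral_filter_of_dominated_convergence
    (K.indicator fun _ => C * (L * R) ^ 2) (.of_forall fun s => ?_) ?_ ?_ ?_
  · exact Continuous.aestronglyMeasurable (by fun_prop)
  · filter_upwards [Ioc_mem_nhdsGT (zero_lt_one' ℝ)] with s hs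
    refine .of_forall fun p => ?_
    by_cases hp : ρ (‖p.1‖ ^ 2) * ‖φ (p.2 + s • p.1) - φ p.2‖ ^ 2 = 0
    · rw [hp, mul_zero, norm_zero]
      exact Set.indicator_nonneg
        (fun _ _ => mul_nonneg ((norm_nonneg _).trans (hC 0)) (sq_nonneg _)) _
    · rw [Set.indicator_of_mem
        (mem_closedBall_prod_cthickening_of_weighted_difference_ne_zero hR hs.1.le hs.2 hp)]
      have hlip : ‖φ (p.2 + s • p.1) - φ p.2‖ ≤ s * (L * R) := by
        calc ‖φ (p.2 + s • p.1) - φ p.2‖ ≤ L * ‖s • p.1‖ := by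
              simpa [dist_eq_norm] using hL.dist_le_mul (p.2 + s • p.1) p.2
          _ = s * (L * ‖p.1‖) := by
              rw [norm_smul, Real.norm_of_nonneg hs.1.le]
              ring
          _ ≤ s * (L * R) := by
              have := hR _ (left_ne_zero_of_mul hp)
              have := hs.1.le
              gcongr
      have hs₀ := hs.1
      calc ‖(s ^ 2)⁻¹ * (ρ (‖p.1‖ ^ 2) * ‖φ (p.2 + s • p.1) - φ p.2‖ ^ 2)‖
          = (s ^ 2)⁻¹ * (‖ρ (‖p.1‖ ^ 2)‖ * ‖φ (p.2 + s • p.1) - φ p.2‖ ^ 2) := by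
            simp
        _ ≤ (s ^ 2)⁻¹ * (C * (s * (L * R)) ^ 2) := by
            gcongr
            · exact (norm_nonneg _).trans (hC 0)
            · exact hC _
        _ = C * (L * R) ^ 2 := by
            field_simp
  · rw [integrable_indicator_iff hK.measurableSet]
    exact integrableOn_const hK.measure_lt_top.ne
  · refine .of_forall fun p => ?_
    have hd : HasFDerivAt φ (fderiv ℝ φ p.2) p.2 :=
      (hφc.differentiable one_ne_zero).differentiableAt.hasFDerivAt
    refine (((hd.hasLineDerivAt p.1).tendsto_slope_zero_right.norm.pow 2).const_mul
      (ρ (‖p.1‖ ^ 2))).congr fun s => ?_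
    rw [norm_smul, norm_inv, mul_pow, inv_pow, Real.norm_eq_abs, sq_abs]
    ring

end DifferenceQuotient

lemma card_mul_integral_comp_norm_sq_mul_norm_fderiv_sq {ι E : Type*} [Fintype ι]
    [NormedAddCommGroup E] [InnerProductSpace ℝ E] [FiniteDimensional ℝ E] [MeasurableSpace E]
    [BorelSpace E] {ρ : ℝ → ℝ} {φ : E → ℂ} (hρc : Continuous ρ)
    (hρ : HasCompactSupport ρ) (hφc : ContDiff ℝ 1 φ) (hφ : HasCompactSupport φ)
    (b : OrthonormalBasis ι ℝ E) :
    Fintype.card ι * ∫ p : E × E, ρ (‖p.1‖ ^ 2) * ‖fderiv ℝ φ p.2 p.1‖ ^ 2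
      = (∫ z : E, ρ (‖z‖ ^ 2) * ‖z‖ ^ 2) * ∫ y : E, ∑ i, ‖fderiv ℝ φ y (b i)‖ ^ 2 := by
  have hφ' : Continuous (fderiv ℝ φ) := hφc.continuous_fderiv one_ne_zero
  have hint : Integrable fun p : E × E => ρ (‖p.1‖ ^ 2) * ‖fderiv ℝ φ p.2 p.1‖ ^ 2 := by
    refine Continuous.integrable_of_hasCompactSupport (by fun_prop)
      (.of_support_subset_isCompact
        ((hρ.comp_norm_sq (E := E)).isCompact.prod (hφ.fderiv ℝ).isCompact) fun p hp => ?_)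
    refine ⟨subset_tsupport _ (left_ne_zero_of_mul hp), subset_tsupport _ fun h => ?_⟩
    simp [h] at hp
  rw [Measure.volume_eq_prod, integral_prod_symm _ hint, ← integral_const_mul,
    ← integral_const_mul]
  congr with y
  dsimp only
  rw [card_mul_integral_comp_norm_sq_mul_norm_apply_sq hρc hρ b (fderiv ℝ φ y), mul_comm]

/-- For continuous compactly supported `ρ ≥ 0` and smooth compactly supported `φ`,
`(2t)⁻¹ ∬ t^{-d/2} ρ(|x-y|²/t) |φ(x)-φ(y)|² d(x,y) → (2d)⁻¹ (∫ ρ(|x|²)|x|² dx) ∫ |∇φ|²`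
as `t → 0⁺`. -/
theorem tendsto_double_integral_gradient
    (d : ℕ) (hd : 1 ≤ d)
    (ρ : ℝ → ℝ) (hρcont : Continuous ρ) (hρsupp : HasCompactSupport ρ)
    (hρnonneg : ∀ s, 0 ≤ ρ s)
    (φ : EuclideanSpace ℝ (Fin d) → ℂ)
    (hφ : ContDiff ℝ (⊤ : ℕ∞) φ) (hφc : HasCompactSupport φ) :
    Tendsto
      (fun t : ℝ => (2 * t)⁻¹ * ∫ p : EuclideanSpace ℝ (Fin d) × EuclideanSpace ℝ (Fin d),
        t ^ (-(d : ℝ) / 2) * ρ (‖p.1 - p.2‖ ^ 2 / t) * ‖φ p.1 - φ p.2‖ ^ 2)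
      (nhdsWithin 0 (Set.Ioi 0))
      (nhds ((2 * (d : ℝ))⁻¹ * (∫ x : EuclideanSpace ℝ (Fin d), ρ (‖x‖ ^ 2) * ‖x‖ ^ 2) *
        ∫ x : EuclideanSpace ℝ (Fin d),
          ∑ i : Fin d, ‖fderiv ℝ φ x (EuclideanSpace.single i 1)‖ ^ 2)) := by
  have hd₀ : (d : ℝ) ≠ 0 := by positivity
  have hφ₁ : ContDiff ℝ 1 φ := hφ.of_le (by exact_mod_cast le_top)
  have hlim := ((tendsto_integral_weighted_difference_quotient hρcont hρsupp hφ₁ hφc).comp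
    (tendsto_nhdsWithin_iff.mpr ⟨(Real.continuous_sqrt.tendsto' 0 0 Real.sqrt_zero).mono_left
      nhdsWithin_le_nhds, eventually_mem_nhdsWithin.mono fun t ht => Real.sqrt_pos.mpr ht⟩ :
      Tendsto Real.sqrt (𝓝[>] 0) (𝓝[>] 0))).const_mul (2⁻¹ : ℝ)
  have hmoment := card_mul_integral_comp_norm_sq_mul_norm_fderiv_sq hρcont hρsupp hφ₁ hφc
    (EuclideanSpace.basisFun (Fin d) ℝ)
  simp only [Fintype.card_fin, EuclideanSpace.basisFun_apply] at hmoment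
  rw [mul_assoc, ← hmoment, mul_inv, mul_assoc, inv_mul_cancel_left₀ hd₀]
  refine hlim.congr' ?_
  filter_upwards [Ioc_mem_nhdsGT (zero_lt_one' ℝ)] with t ht
  have hs₀ : 0 < √t := Real.sqrt_pos.mpr ht.1
  have hst : √t ^ 2 = t := Real.sq_sqrt ht.1.le
  have hrescale := integral_weighted_difference_rescale hρcont hρsupp hφ.continuous hφc hs₀
    (Real.sqrt_le_one.mpr ht.2)
  have hpow : t ^ (-(d : ℝ) / 2) * √t ^ d = 1 := by
    rw [← Real.rpow_natCast, Real.sqrt_eq_rpow, ← Real.rpow_mul ht.1.le, ← Real.rpow_add ht.1]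
    ring_nf
    exact Real.rpow_zero t
  rw [hst, finrank_euclideanSpace_fin] at hrescale
  simp_rw [mul_assoc (t ^ (-(d : ℝ) / 2)), integral_const_mul]
  rw [hrescale, ← mul_assoc (t ^ _), hpow, one_mul, mul_inv, mul_assoc, Function.comp_apply, hst]
end

section
/- Let d ≥ 1, r > 0, and let φ : ℝ^d → ℂ be smooth with compact support. Then lim_{t→0⁺} (2t)^{−1} t^{−d/2} ∫∫_{\{(x,y) : |x−y| ≤ r t^{1/2}\}} |φ(x) − φ(y)|² d(x,y) = (2d)^{−1} ( ∫_{\{|x| ≤ r\}} |x|² dx ) ∫_{ℝ^d} |∇φ(x)|² dx. In particular, for every a > 0 there is μ > 0, depending only on d, a and r, such that lim inf_{t→0⁺} a (2t)^{−1} t^{−d/2} ∫∫_{\{|x−y| ≤ r t^{1/2}\}} |φ(x) − φ(y)|² d(x,y) ≥ μ ∫_{ℝ^d} |∇φ(x)|² dx for all such φ. -/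
open MeasureTheory Filter

section Shear

variable {E : Type*} [NormedAddCommGroup E] [NormedSpace ℝ E] [FiniteDimensional ℝ E]
  [MeasurableSpace E] [BorelSpace E]

/-- The integral over a tube around the diagonal in the coordinates `(x, z) ↦ (x, x + s • z)`. -/
theorem setIntegral_norm_sub_le_mul_eq {G : Type*} [NormedAddCommGroup G] [NormedSpace ℝ G]
    (μ : Measure E) [μ.IsAddHaarMeasure] (f : E × E → G) (r : ℝ) {s : ℝ} (hs : 0 < s) :
    ∫ p in {p : E × E | ‖p.1 - p.2‖ ≤ r * s}, f p ∂μ.prod μ =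
      s ^ Module.finrank ℝ E • ∫ q, f (q.1, q.1 + s • q.2)
        ∂μ.prod (μ.restrict (Metric.closedBall 0 r)) := by
  set n := Module.finrank ℝ E
  let T : E × E ≃ᵐ E × E := ((MeasurableEquiv.refl E).prodCongr
    (Homeomorph.smulOfNeZero s hs.ne').toMeasurableEquiv).trans (MeasurableEquiv.shearAddRight E)
  have hT : ∀ q, T q = (q.1, q.1 + s • q.2) := fun q => rfl
  have hmap : Measure.map T (μ.prod μ) = ENNReal.ofReal ((s ^ n)⁻¹) • μ.prod μ := by
    have h1 : Measure.map (Prod.map id fun z : E => s • z) (μ.prod μ) =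
        ENNReal.ofReal ((s ^ n)⁻¹) • μ.prod μ := by
      rw [← Measure.map_prod_map _ _ measurable_id (measurable_const_smul s), Measure.map_id,
        Measure.map_addHaar_smul μ hs.ne', abs_of_pos (by positivity), Measure.prod_smul_right]
    have h2 := (measurePreserving_prod_add μ μ).map_eq
    have : (T : E × E → E × E) =
        (fun z : E × E => (z.1, z.1 + z.2)) ∘ Prod.map id fun z : E => s • z := rfl
    rw [this, ← Measure.map_map (by fun_prop) (by fun_prop), h1, Measure.map_smul, h2]
  have hpre : T ⁻¹' {p : E × E | ‖p.1 - p.2‖ ≤ r * s} = Set.univ ×ˢ Metric.closedBall 0 r := by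
    ext q
    simp only [Set.mem_preimage, hT, Set.mem_ofPred_eq, sub_add_cancel_left, norm_neg, norm_smul,
      Real.norm_eq_abs, abs_of_pos hs, Set.mem_prod, Set.mem_univ, true_and,
      mem_closedBall_zero_iff]
    rw [mul_comm, mul_le_mul_iff_left₀ hs]
  have hprod : μ.prod (μ.restrict (Metric.closedBall 0 r)) =
      (μ.prod μ).restrict (Set.univ ×ˢ Metric.closedBall 0 r) := by
    rw [← Measure.prod_restrict, Measure.restrict_univ]
  have key := T.measurableEmbedding.setIntegral_map (μ := μ.prod μ) f
    {p : E × E | ‖p.1 - p.2‖ ≤ r * s}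
  rw [hmap, hpre, Measure.restrict_smul, integral_smul_measure,
    ENNReal.toReal_ofReal (by positivity)] at key
  simp only [hT] at key
  rw [hprod, ← key, smul_smul, mul_inv_cancel₀ (by positivity), one_smul]

/-- The rescaled squared increments of a compactly supported `C¹` function converge in mean to
the squared directional derivatives. -/
theorem tendsto_integral_norm_sub_sq_div_sq {F : Type*} [NormedAddCommGroup F] [NormedSpace ℝ F]
    (μ : Measure E) [μ.IsAddHaarMeasure] {φ : E → F} (hφ : ContDiff ℝ 1 φ)
    (hφc : HasCompactSupport φ) {r : ℝ} (hr : 0 ≤ r) :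
    Tendsto (fun s : ℝ => ∫ q, ‖φ q.1 - φ (q.1 + s • q.2)‖ ^ 2 / s ^ 2
        ∂μ.prod (μ.restrict (Metric.closedBall 0 r)))
      (nhdsWithin 0 (Set.Ioi 0))
      (nhds (∫ q, ‖fderiv ℝ φ q.1 q.2‖ ^ 2 ∂μ.prod (μ.restrict (Metric.closedBall 0 r)))) := by
  obtain ⟨C, hC⟩ := hφ.lipschitzWith_of_hasCompactSupport hφc one_ne_zero
  set K := Metric.cthickening r (tsupport φ)
  have hK : IsCompact K := hφc.isCompact.cthickening
  have hcont := hφ.continuous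
  have hball : ∀ᵐ q ∂μ.prod (μ.restrict (Metric.closedBall (0 : E) r)), ‖q.2‖ ≤ r := by
    have := ae_restrict_mem (μ := μ)
      (Metric.isClosed_closedBall (x := (0 : E)) (ε := r)).measurableSet
    filter_upwards [Measure.quasiMeasurePreserving_snd.ae this] with q hq
    simpa using hq
  apply tendsto_integral_filter_of_dominated_convergence
    (fun q => (K ×ˢ Set.univ).indicator (fun _ : E × E => ((C : ℝ) * r) ^ 2) q)
  · exact Eventually.of_forall fun s => by
      apply Continuous.aestronglyMeasurable
      fun_prop
  · have h1 : ∀ᶠ s : ℝ in nhdsWithin 0 (Set.Ioi 0), s ∈ Set.Ioc (0 : ℝ) 1 :=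
      Ioc_mem_nhdsGT one_pos
    filter_upwards [h1] with s hs
    filter_upwards [hball] with q hq
    have hs0 := hs.1
    by_cases hqK : q.1 ∈ K
    · rw [Set.indicator_of_mem (by simpa using hqK), Real.norm_of_nonneg (by positivity),
        div_le_iff₀ (by positivity), ← mul_pow]
      gcongr
      calc ‖φ q.1 - φ (q.1 + s • q.2)‖ ≤ C * ‖q.1 - (q.1 + s • q.2)‖ := hC.norm_sub_le _ _
        _ = C * (s * ‖q.2‖) := by
          rw [sub_add_cancel_left, norm_neg, norm_smul, Real.norm_of_nonneg hs0.le]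
        _ ≤ C * (s * r) := by gcongr
        _ = C * r * s := by ring
    · have h0 : ∀ y, dist q.1 y ≤ r → φ y = 0 := fun y hy => by
        by_contra hne
        exact hqK (Metric.mem_cthickening_of_dist_le _ y _ _ (subset_tsupport _ hne) hy)
      rw [Set.indicator_of_notMem (by simpa using hqK), h0 q.1 (by simpa using hr),
        h0 (q.1 + s • q.2)]
      · simp
      · rw [dist_self_add_right, norm_smul, Real.norm_of_nonneg hs0.le]
        nlinarith [hs.2, norm_nonneg q.2]
  · refine (integrable_indicator_iff (hK.isClosed.measurableSet.prod MeasurableSet.univ)).2 ?_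
    refine integrableOn_const ?_
    rw [Measure.prod_prod, Measure.restrict_apply_univ]
    exact (ENNReal.mul_lt_top hK.measure_lt_top
      (isCompact_closedBall (0 : E) r).measure_lt_top).ne
  · refine Eventually.of_forall fun q => ?_
    have h := ((hφ.differentiable one_ne_zero q.1).hasFDerivAt.hasLineDerivAt
      q.2).tendsto_slope_zero_right.norm.pow 2
    refine h.congr fun s => ?_
    rw [norm_smul, mul_pow, norm_inv, inv_pow, Real.norm_eq_abs, sq_abs, norm_sub_rev,
      div_eq_inv_mul]

end Shear

section Isotropy

variable {E : Type*} [NormedAddCommGroup E] [InnerProductSpace ℝ E] [FiniteDimensional ℝ E]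
  [MeasurableSpace E] [BorelSpace E] {ι : Type*} [Fintype ι]

theorem setIntegral_closedBall_inner_sq_eq_of_norm_eq {v w : E} (h : ‖v‖ = ‖w‖) (r : ℝ) :
    ∫ z in Metric.closedBall 0 r, inner ℝ v z ^ 2 =
      ∫ z in Metric.closedBall 0 r, inner ℝ w z ^ 2 := by
  set R := (ℝ ∙ (v - w))ᗮ.reflection
  have hR : R v = w := Submodule.reflection_sub h
  have key := R.measurePreserving.setIntegral_preimage_emb
    R.toMeasurableEquiv.measurableEmbedding (fun z => inner ℝ w z ^ 2) (Metric.closedBall 0 r)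
  rw [← key, R.preimage_closedBall]
  simp [← hR]

theorem finrank_mul_setIntegral_closedBall_inner_sq (v : E) (r : ℝ) :
    (Module.finrank ℝ E : ℝ) * ∫ z in Metric.closedBall 0 r, inner ℝ v z ^ 2 =
      ‖v‖ ^ 2 * ∫ z in Metric.closedBall (0 : E) r, ‖z‖ ^ 2 := by
  let b := stdOrthonormalBasis ℝ E
  have hb : ∀ i, ∫ z in Metric.closedBall 0 r, inner ℝ v z ^ 2 =
      ‖v‖ ^ 2 * ∫ z in Metric.closedBall 0 r, inner ℝ (b i) z ^ 2 := fun i => by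
    rw [setIntegral_closedBall_inner_sq_eq_of_norm_eq (w := ‖v‖ • b i) (by simp [norm_smul]),
      ← integral_const_mul]
    simp only [real_inner_smul_left, mul_pow]
  have hint : ∀ i, IntegrableOn (fun z => inner ℝ (b i) z ^ 2) (Metric.closedBall 0 r) := fun i =>
    ContinuousOn.integrableOn_compact (isCompact_closedBall _ _) (by fun_prop)
  calc (Module.finrank ℝ E : ℝ) * ∫ z in Metric.closedBall 0 r, inner ℝ v z ^ 2
      = ∑ _i : Fin (Module.finrank ℝ E), ∫ z in Metric.closedBall 0 r, inner ℝ v z ^ 2 := by simp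
    _ = ‖v‖ ^ 2 * ∑ i, ∫ z in Metric.closedBall 0 r, inner ℝ (b i) z ^ 2 := by
      rw [Finset.mul_sum]
      exact Finset.sum_congr rfl fun i _ => hb i
    _ = _ := by
      rw [← integral_finsetSum _ fun i _ => hint i]
      simp only [b.sum_sq_inner_right]

theorem finrank_mul_setIntegral_closedBall_norm_apply_sq (b : OrthonormalBasis ι ℝ E)
    (L : E →L[ℝ] ℂ) (r : ℝ) :
    (Module.finrank ℝ E : ℝ) * ∫ z in Metric.closedBall 0 r, ‖L z‖ ^ 2 =
      (∑ i, ‖L (b i)‖ ^ 2) * ∫ z in Metric.closedBall (0 : E) r, ‖z‖ ^ 2 := by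
  let u := (InnerProductSpace.toDual ℝ E).symm (Complex.reCLM.comp L)
  let v := (InnerProductSpace.toDual ℝ E).symm (Complex.imCLM.comp L)
  have hL : ∀ z, ‖L z‖ ^ 2 = inner ℝ u z ^ 2 + inner ℝ v z ^ 2 := fun z => by
    simp only [u, v, InnerProductSpace.toDual_symm_apply, ContinuousLinearMap.comp_apply,
      Complex.reCLM_apply, Complex.imCLM_apply, Complex.sq_norm, Complex.normSq_apply]
    ring
  have hint : ∀ w : E, IntegrableOn (fun z => inner ℝ w z ^ 2) (Metric.closedBall 0 r) := fun w =>
    ContinuousOn.integrableOn_compact (isCompact_closedBall _ _) (by fun_prop)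
  simp only [hL]
  rw [integral_add (hint u) (hint v), mul_add, finrank_mul_setIntegral_closedBall_inner_sq,
    finrank_mul_setIntegral_closedBall_inner_sq, ← add_mul, Finset.sum_add_distrib,
    b.sum_sq_inner_left, b.sum_sq_inner_left]

theorem setIntegral_closedBall_norm_sq_pos [Nontrivial E] {r : ℝ} (hr : 0 < r) :
    0 < ∫ z in Metric.closedBall (0 : E) r, ‖z‖ ^ 2 := by
  rw [setIntegral_pos_iff_support_of_nonneg_ae (Eventually.of_forall fun z => by positivity)
    (ContinuousOn.integrableOn_compact (isCompact_closedBall _ _) (by fun_prop))]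
  have hsupp : Function.support (fun z : E => ‖z‖ ^ 2) = {0}ᶜ := by ext; simp
  rw [hsupp, Set.inter_comm, ← Set.sdiff_eq, measure_sdiff_null (measure_singleton 0)]
  exact Metric.measure_closedBall_pos _ _ hr

/-- Short-range squared increments of a compactly supported `C¹` function recover its Dirichlet
energy. -/
theorem tendsto_tube_integral_norm_sub_sq (b : OrthonormalBasis ι ℝ E)
    (hE : 0 < Module.finrank ℝ E) {φ : E → ℂ} (hφ : ContDiff ℝ 1 φ) (hφc : HasCompactSupport φ)
    {r : ℝ} (hr : 0 ≤ r) :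
    Tendsto
      (fun t : ℝ => (2 * t)⁻¹ * t ^ (-(Module.finrank ℝ E : ℝ) / 2) *
        ∫ p in {p : E × E | ‖p.1 - p.2‖ ≤ r * √t}, ‖φ p.1 - φ p.2‖ ^ 2)
      (nhdsWithin 0 (Set.Ioi 0))
      (nhds ((2 * (Module.finrank ℝ E : ℝ))⁻¹ *
        (∫ z in Metric.closedBall (0 : E) r, ‖z‖ ^ 2) * ∫ x, ∑ i, ‖fderiv ℝ φ x (b i)‖ ^ 2)) := by
  set n := Module.finrank ℝ E
  have hn : (n : ℝ) ≠ 0 := by exact_mod_cast hE.ne'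
  have hcont : Continuous fun q : E × E => ‖fderiv ℝ φ q.1 q.2‖ ^ 2 := by
    have := hφ.continuous_fderiv one_ne_zero
    fun_prop
  have hint : Integrable (fun q : E × E => ‖fderiv ℝ φ q.1 q.2‖ ^ 2)
      (volume.prod (volume.restrict (Metric.closedBall 0 r))) := by
    have hK : IsCompact (tsupport φ) := hφc
    have hon : IntegrableOn (fun q : E × E => ‖fderiv ℝ φ q.1 q.2‖ ^ 2)
        (tsupport φ ×ˢ Metric.closedBall 0 r) (volume.prod volume) :=
      hcont.continuousOn.integrableOn_compact (hK.prod (isCompact_closedBall _ _))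
    rw [IntegrableOn, ← Measure.prod_restrict] at hon
    have hon' : IntegrableOn (fun q : E × E => ‖fderiv ℝ φ q.1 q.2‖ ^ 2)
        (tsupport φ ×ˢ Set.univ) (volume.prod (volume.restrict (Metric.closedBall 0 r))) := by
      rwa [IntegrableOn, ← Measure.prod_restrict, Measure.restrict_univ]
    refine (integrableOn_iff_integrable_of_support_subset fun q hq => ?_).1 hon'
    refine ⟨support_fderiv_subset ℝ fun h => hq ?_, trivial⟩
    simp [h]
  have hlim : ∫ q, ‖fderiv ℝ φ q.1 q.2‖ ^ 2
        ∂(volume : Measure E).prod (volume.restrict (Metric.closedBall 0 r)) =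
      (n : ℝ)⁻¹ * (∫ z in Metric.closedBall (0 : E) r, ‖z‖ ^ 2) *
        ∫ x, ∑ i, ‖fderiv ℝ φ x (b i)‖ ^ 2 := by
    rw [integral_prod _ hint, ← integral_const_mul]
    congr 1 with x
    rw [mul_assoc, mul_comm (∫ z in _, _), ← finrank_mul_setIntegral_closedBall_norm_apply_sq,
      inv_mul_cancel_left₀ hn]
  have hsqrt : Tendsto Real.sqrt (nhdsWithin 0 (Set.Ioi 0)) (nhdsWithin 0 (Set.Ioi 0)) := by
    refine tendsto_nhdsWithin_iff.2 ⟨?_, ?_⟩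
    · simpa using (Real.continuous_sqrt.tendsto 0).mono_left nhdsWithin_le_nhds
    · filter_upwards [self_mem_nhdsWithin] with t ht using Real.sqrt_pos.2 ht
  have hmain := ((tendsto_integral_norm_sub_sq_div_sq volume hφ hφc hr).comp hsqrt).const_mul
    (2⁻¹ : ℝ)
  rw [hlim, mul_assoc, ← mul_assoc, ← mul_inv, ← mul_assoc] at hmain
  refine hmain.congr' ?_
  filter_upwards [self_mem_nhdsWithin] with t ht
  have ht0 : (0 : ℝ) < t := ht
  have hpow : t ^ (-(n : ℝ) / 2) * √t ^ n = 1 := by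
    rw [← Real.rpow_natCast, Real.sqrt_eq_rpow, ← Real.rpow_mul ht0.le, ← Real.rpow_add ht0]
    ring_nf
    simp
  rw [Measure.volume_eq_prod, setIntegral_norm_sub_le_mul_eq volume _ r (Real.sqrt_pos.2 ht0),
    Function.comp_apply, integral_div, Real.sq_sqrt ht0.le, smul_eq_mul, mul_assoc (2 * t)⁻¹,
    ← mul_assoc (t ^ _), hpow, one_mul, mul_inv]
  ring

end Isotropy

/-- For smooth compactly supported `φ`,
`(2t)⁻¹ t^{-d/2} ∬_{|x-y| ≤ r√t} |φ(x)-φ(y)|² → (2d)⁻¹ (∫_{|x| ≤ r} |x|²) ∫ |∇φ|²` as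
`t → 0⁺`; in particular for every `a > 0` there is `μ > 0`, depending only on `d`, `a`
and `r`, with `liminf_{t→0⁺} a (2t)⁻¹ t^{-d/2} ∬_{|x-y| ≤ r√t} |φ(x)-φ(y)|² ≥ μ ∫ |∇φ|²`
for all such `φ`. -/
theorem tendsto_ball_double_integral_gradient_and_liminf_bound
    (d : ℕ) (hd : 1 ≤ d) (r : ℝ) (hr : 0 < r)
    (φ : EuclideanSpace ℝ (Fin d) → ℂ)
    (hφ : ContDiff ℝ (⊤ : ℕ∞) φ) (hφc : HasCompactSupport φ) :
    Tendsto
      (fun t : ℝ => (2 * t)⁻¹ * t ^ (-(d : ℝ) / 2) *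
        ∫ p in {p : EuclideanSpace ℝ (Fin d) × EuclideanSpace ℝ (Fin d) |
            ‖p.1 - p.2‖ ≤ r * Real.sqrt t}, ‖φ p.1 - φ p.2‖ ^ 2)
      (nhdsWithin 0 (Set.Ioi 0))
      (nhds ((2 * (d : ℝ))⁻¹ * (∫ x in {x : EuclideanSpace ℝ (Fin d) | ‖x‖ ≤ r}, ‖x‖ ^ 2) *
        ∫ x : EuclideanSpace ℝ (Fin d),
          ∑ i : Fin d, ‖fderiv ℝ φ x (EuclideanSpace.single i 1)‖ ^ 2)) ∧
    ∀ a : ℝ, 0 < a → ∃ μ : ℝ, 0 < μ ∧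
      ∀ ψ : EuclideanSpace ℝ (Fin d) → ℂ, ContDiff ℝ (⊤ : ℕ∞) ψ → HasCompactSupport ψ →
        μ * ∫ x : EuclideanSpace ℝ (Fin d),
            ∑ i : Fin d, ‖fderiv ℝ ψ x (EuclideanSpace.single i 1)‖ ^ 2 ≤
          liminf
            (fun t : ℝ => a * ((2 * t)⁻¹ * t ^ (-(d : ℝ) / 2) *
              ∫ p in {p : EuclideanSpace ℝ (Fin d) × EuclideanSpace ℝ (Fin d) |
                  ‖p.1 - p.2‖ ≤ r * Real.sqrt t}, ‖ψ p.1 - ψ p.2‖ ^ 2))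
            (nhdsWithin 0 (Set.Ioi 0)) := by
  have hlim (ψ : EuclideanSpace ℝ (Fin d) → ℂ) (hψ : ContDiff ℝ (⊤ : ℕ∞) ψ)
      (hψc : HasCompactSupport ψ) :=
    tendsto_tube_integral_norm_sub_sq (EuclideanSpace.basisFun (Fin d) ℝ)
      (by simpa using Nat.lt_of_lt_of_le one_pos hd) (hψ.of_le (by simp)) hψc hr.le
  have hset : Metric.closedBall 0 r = {x : EuclideanSpace ℝ (Fin d) | ‖x‖ ≤ r} := by
    ext; simp
  simp only [finrank_euclideanSpace, Fintype.card_fin, EuclideanSpace.basisFun_apply] at hlim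
  refine ⟨hset ▸ hlim φ hφ hφc, fun a ha =>
    ⟨a * ((2 * (d : ℝ))⁻¹ * ∫ z in Metric.closedBall (0 : EuclideanSpace ℝ (Fin d)) r, ‖z‖ ^ 2),
      ?_, fun ψ hψ hψc => ?_⟩⟩
  · have : NeZero d := ⟨by omega⟩
    have := setIntegral_closedBall_norm_sq_pos (E := EuclideanSpace ℝ (Fin d)) hr
    positivity
  · rw [mul_assoc]
    exact ((hlim ψ hψ hψc).const_mul a).liminf_eq.ge
end
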